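/- Consider a run of LightONS over T rounds on the domain X with d ≥ 1, hysteresis coefficient k = 2, exact Mahalanobis projections, and surrogate gradients chosen as v_t = ∇f_t(x_t) if y_t ∈ X, and otherwise v_t = ∇f_t(x_t) + (max{0, −∇f_t(x_t)ᵀ(y_t − x_t)}/‖y_t − x_t‖²)·(y_t − x_t), where x_t is the Euclidean projection of y_t onto X (so the surrogate-gradient conditions hold with c_f = c_g = 1). Then for every u ∈ X, Σ_{t=1}^{T} (f_t(x_t) − f_t(u)) ≤ (d/(2γ₀))·log(1 + G²·T/(d·ε)) + γ₀·ε·D²/8, where γ₀ = (1/2)·min{1/(DG), α}. -/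

import Mathlib

open scoped RealInnerProductSpace

noncomputable def mApp {d : ℕ} (A : Matrix (Fin d) (Fin d) ℝ) (x : EuclideanSpace ℝ (Fin d)) :
    EuclideanSpace ℝ (Fin d) :=
  Matrix.toEuclideanLin A x

noncomputable def quadForm {d : ℕ} (A : Matrix (Fin d) (Fin d) ℝ) (x : EuclideanSpace ℝ (Fin d)) : ℝ :=
  ⟪x, mApp A x⟫

noncomputable def mnorm {d : ℕ} (A : Matrix (Fin d) (Fin d) ℝ) (x : EuclideanSpace ℝ (Fin d)) : ℝ :=
  Real.sqrt (quadForm A x)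

/-- `p` is a Mahalanobis projection of `y` onto `C` with respect to `A`. -/
def IsMProj {d : ℕ} (A : Matrix (Fin d) (Fin d) ℝ) (C : Set (EuclideanSpace ℝ (Fin d)))
    (y p : EuclideanSpace ℝ (Fin d)) : Prop :=
  p ∈ C ∧ ∀ z ∈ C, mnorm A (p - y) ≤ mnorm A (z - y)

/-- The outer product `v vᵀ` of a vector with itself. -/
noncomputable def outerProd {d : ℕ} (v : EuclideanSpace ℝ (Fin d)) : Matrix (Fin d) (Fin d) ℝ :=
  Matrix.of (fun i j => v i * v j)

namespace LightONS

section Analysis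

variable {E : Type*} [NormedAddCommGroup E] [InnerProductSpace ℝ E]

lemma one_add_le_exp_sub_sq {y : ℝ} (hy : |y| ≤ 1) : 1 + y ≤ Real.exp (y - y ^ 2 / 4) := by
  obtain ⟨h₁, h₂⟩ := abs_le.mp hy
  rcases le_total 0 y with h | h
  · have ht : 0 ≤ y - y ^ 2 / 4 := by nlinarith
    have := Real.quadratic_le_exp_of_nonneg ht
    nlinarith [mul_nonneg h h, mul_nonneg (mul_nonneg h h) h,
      mul_nonneg (mul_nonneg h h) (sub_nonneg.2 h₂)]
  · set s : ℝ := (y - y ^ 2 / 4) / 2 with hs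
    have hexp : Real.exp (y - y ^ 2 / 4) = Real.exp s ^ 2 := by
      rw [← Real.exp_nat_mul]; congr 1; rw [hs]; push_cast; ring
    have hs0 : 0 ≤ s + 1 := by rw [hs]; nlinarith
    have := pow_le_pow_left₀ hs0 (Real.add_one_le_exp s) 2
    rw [hexp]
    refine le_trans ?_ this
    rw [hs]
    nlinarith [mul_nonneg (sq_nonneg y) (neg_nonneg.2 h), sq_nonneg (y ^ 2)]

lemma nonneg_of_forall_quadratic {b c : ℝ}
    (h : ∀ s : ℝ, 0 ≤ s → s ≤ 1 → 0 ≤ 2 * s * b + s ^ 2 * c) : 0 ≤ b := by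
  by_contra! hb
  set s : ℝ := min 1 (-b / (|c| + 1)) with hs
  have hc : 0 < |c| + 1 := by positivity
  have hs0 : 0 < s := lt_min one_pos (div_pos (neg_pos.2 hb) hc)
  have hsb : s * (|c| + 1) ≤ -b := (le_div_iff₀ hc).1 (min_le_right _ _)
  have := h s hs0.le (min_le_left _ _)
  have h' : 0 ≤ s * (2 * b + s * c) := by linarith
  have h'' := nonneg_of_mul_nonneg_right h' hs0
  nlinarith [le_abs_self c]

lemma inner_sub_nonneg_of_norm_minimal {C : Set E} (hC : Convex ℝ C) {x y : E} (hx : x ∈ C)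
    (hmin : ∀ z ∈ C, ‖x - y‖ ≤ ‖z - y‖) {u : E} (hu : u ∈ C) : 0 ≤ ⟪x - y, u - x⟫ := by
  refine nonneg_of_forall_quadratic (c := ‖u - x‖ ^ 2) fun s hs₀ hs₁ => ?_
  have h := hmin _ (hC.add_smul_sub_mem hx hu ⟨hs₀, hs₁⟩)
  have h2 := pow_le_pow_left₀ (norm_nonneg _) h 2
  rw [show x + s • (u - x) - y = (x - y) + s • (u - x) by abel, norm_add_sq_real (x - y),
    inner_smul_right, norm_smul, mul_pow, Real.norm_eq_abs, sq_abs] at h2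
  linarith

lemma concaveOn_le_add_deriv {X : Set E} {φ : E → ℝ} (hφ : ConcaveOn ℝ X φ) {x u : E}
    (hx : x ∈ X) (hu : u ∈ X) {φ' : E →L[ℝ] ℝ} (hd : HasFDerivAt φ φ' x) :
    φ u ≤ φ x + φ' (u - x) := by
  let L : ℝ →ᵃ[ℝ] E := AffineMap.lineMap x u
  have hL : ConcaveOn ℝ (L ⁻¹' X) (φ ∘ L) := hφ.comp_affineMap L
  have hderiv : HasDerivAt (φ ∘ L) (φ' (u - x)) 0 := by
    have hd' : HasFDerivAt φ φ' (L 0) := by simpa [L] using hd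
    exact hd'.comp_hasDerivAt 0 AffineMap.hasDerivAt_lineMap
  have := hL.slope_le_of_hasDerivAt (x := 0) (y := 1) (by simpa [L] using hx)
    (by simpa [L] using hu) one_pos hderiv
  simp [slope, L] at this
  rw [map_sub]
  linarith

lemma sub_le_of_expConcave [CompleteSpace E] {X : Set E} {f : E → ℝ} {α γ : ℝ} (hγ : 0 < γ)
    (hγα : 2 * γ ≤ α) (hf : ConcaveOn ℝ X fun z => Real.exp (-α * f z)) {x u g : E} (hx : x ∈ X)
    (hu : u ∈ X) (hg : HasGradientAt f g x) (hbound : 2 * γ * |⟪g, x - u⟫| ≤ 1) :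
    f x - f u ≤ ⟪g, x - u⟫ - γ / 2 * ⟪g, x - u⟫ ^ 2 := by
  have hα : 0 < α := by linarith
  have h₁ := concaveOn_le_add_deriv hf hx hu ((hg.hasFDerivAt.const_mul (-α)).exp)
  set w := ⟪g, x - u⟫ with hw
  have hw' : ⟪g, u - x⟫ = -w := by rw [hw, ← inner_neg_right, neg_sub]
  simp [hw'] at h₁
  have h₂ : Real.exp (α * (f x - f u)) ≤ 1 + α * w := by
    have : Real.exp (α * (f x - f u)) = Real.exp (-(α * f u)) / Real.exp (-(α * f x)) := by
      rw [← Real.exp_sub]; congr 1; ring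
    rw [this, div_le_iff₀ (Real.exp_pos _)]
    linarith
  have h₃ : Real.exp (2 * γ * (f x - f u)) ≤ 1 + 2 * γ * w := by
    have hp : 2 * γ / α ≤ 1 := (div_le_one hα).2 hγα
    have hp0 : 0 ≤ 2 * γ / α := by positivity
    calc Real.exp (2 * γ * (f x - f u)) = Real.exp (α * (f x - f u)) ^ (2 * γ / α) := by
          rw [← Real.exp_mul]; congr 1; field_simp
      _ ≤ (1 + α * w) ^ (2 * γ / α) := by gcongr
      _ ≤ 1 + (2 * γ / α) * (α * w) :=
          rpow_one_add_le_one_add_mul_self (by linarith [Real.exp_pos (α * (f x - f u))])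
            hp0 hp
      _ = 1 + 2 * γ * w := by field_simp
  have h₄ := h₃.trans (one_add_le_exp_sub_sq (y := 2 * γ * w)
    (by rwa [abs_mul, abs_of_pos (by positivity : 0 < 2 * γ)]))
  have h₅ := Real.exp_le_exp.1 h₄
  have : 2 * γ * (f x - f u) ≤ 2 * γ * (w - γ / 2 * w ^ 2) := by linarith [h₅]
  exact le_of_mul_le_mul_left this (by positivity)

/-- The surrogate gradient has no larger norm and a no smaller linearized regret at `y`. -/
lemma surrogate_gradient {g p y u : E} (hyp : y ≠ p) (hproj : 0 ≤ ⟪p - y, u - p⟫) :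
    let v := g + (max 0 (-⟪g, y - p⟫) / ‖y - p‖ ^ 2) • (y - p)
    ‖v‖ ≤ ‖g‖ ∧ ⟪g, p - u⟫ ≤ ⟪v, y - u⟫ := by
  intro v
  have hn : 0 < ‖y - p‖ ^ 2 := by
    have := norm_pos_iff.2 (sub_ne_zero.2 hyp); positivity
  set n := ‖y - p‖ ^ 2 with hn'
  have hyu : n ≤ ⟪y - p, y - u⟫ := by
    have : ⟪y - p, y - u⟫ = n + ⟪p - y, u - p⟫ := by
      rw [hn', ← real_inner_self_eq_norm_sq]
      simp only [inner_sub_left, inner_sub_right]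
      ring
    linarith
  have hgyu : ⟪g, y - u⟫ = ⟪g, y - p⟫ + ⟪g, p - u⟫ := by
    rw [← inner_add_right, sub_add_sub_cancel]
  set m := max 0 (-⟪g, y - p⟫) with hm
  have hm0 : 0 ≤ m := le_max_left _ _
  constructor
  · refine (sq_le_sq₀ (norm_nonneg _) (norm_nonneg _)).1 ?_
    have hv : ‖v‖ ^ 2 = ‖g‖ ^ 2 + 2 * (m / n * ⟪g, y - p⟫) + (m / n) ^ 2 * n := by
      rw [norm_add_sq_real, inner_smul_right, norm_smul, mul_pow, Real.norm_eq_abs, sq_abs]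
    rw [hv, show (m / n) ^ 2 * n = m / n * m by field_simp]
    have : m / n * (2 * ⟪g, y - p⟫ + m) ≤ 0 := by
      rcases le_total 0 (-⟪g, y - p⟫) with h | h
      · refine mul_nonpos_of_nonneg_of_nonpos (by positivity) ?_
        rw [hm, max_eq_right h]; linarith
      · rw [hm, max_eq_left h]; simp
    linarith
  · have : ⟪v, y - u⟫ = ⟪g, y - u⟫ + m / n * ⟪y - p, y - u⟫ := by
      rw [inner_add_left, real_inner_smul_left]
    rw [this, hgyu]
    have h₁ : m / n * n ≤ m / n * ⟪y - p, y - u⟫ := by gcongr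
    rw [div_mul_cancel₀ _ hn.ne'] at h₁
    linarith [le_max_right 0 (-⟪g, y - p⟫)]

end Analysis

section Matrix

variable {d : ℕ}

lemma mApp_add_left (A B : Matrix (Fin d) (Fin d) ℝ) (x : EuclideanSpace ℝ (Fin d)) :
    mApp (A + B) x = mApp A x + mApp B x := by
  simp [mApp]

lemma mApp_mul (A B : Matrix (Fin d) (Fin d) ℝ) (x : EuclideanSpace ℝ (Fin d)) :
    mApp (A * B) x = mApp A (mApp B x) := by
  simp [mApp, Matrix.toLpLin_apply]

lemma mApp_outerProd (v x : EuclideanSpace ℝ (Fin d)) :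
    mApp (outerProd v) x = ⟪v, x⟫ • v := by
  ext i
  simp [mApp, outerProd, Matrix.toLpLin_apply, Matrix.mulVec, dotProduct, PiLp.inner_apply,
    Finset.sum_mul]
  exact Finset.sum_congr rfl fun j _ => by ring

lemma inner_mApp_comm {A : Matrix (Fin d) (Fin d) ℝ} (hA : A.IsHermitian)
    (x y : EuclideanSpace ℝ (Fin d)) : ⟪x, mApp A y⟫ = ⟪y, mApp A x⟫ := by
  rw [real_inner_comm]
  exact Matrix.isSymmetric_toEuclideanLin_iff.2 hA y x

lemma quadForm_add {A : Matrix (Fin d) (Fin d) ℝ} (hA : A.IsHermitian)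
    (x y : EuclideanSpace ℝ (Fin d)) :
    quadForm A (x + y) = quadForm A x + 2 * ⟪x, mApp A y⟫ + quadForm A y := by
  have : mApp A (x + y) = mApp A x + mApp A y := map_add _ _ _
  simp only [quadForm, this, inner_add_left, inner_add_right, inner_mApp_comm hA y x]
  ring

lemma quadForm_smul (A : Matrix (Fin d) (Fin d) ℝ) (s : ℝ) (x : EuclideanSpace ℝ (Fin d)) :
    quadForm A (s • x) = s ^ 2 * quadForm A x := by
  have : mApp A (s • x) = s • mApp A x := map_smul _ _ _
  simp only [quadForm, this, inner_smul_right, real_inner_smul_left]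
  ring

lemma quadForm_add_outerProd (A : Matrix (Fin d) (Fin d) ℝ) (v x : EuclideanSpace ℝ (Fin d)) :
    quadForm (A + outerProd v) x = quadForm A x + ⟪v, x⟫ ^ 2 := by
  simp only [quadForm, mApp_add_left, mApp_outerProd, inner_add_right, inner_smul_right,
    real_inner_comm v x]
  ring

lemma quadForm_nonneg {A : Matrix (Fin d) (Fin d) ℝ} (hA : A.PosDef)
    (x : EuclideanSpace ℝ (Fin d)) : 0 ≤ quadForm A x := by
  have := hA.posSemidef.dotProduct_mulVec_nonneg x.ofLp
  simpa [quadForm, mApp, Matrix.toLpLin_apply, PiLp.inner_apply, dotProduct, mul_comm] using this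

lemma quadForm_smul_one (ε : ℝ) (x : EuclideanSpace ℝ (Fin d)) :
    quadForm (ε • (1 : Matrix (Fin d) (Fin d) ℝ)) x = ε * ‖x‖ ^ 2 := by
  simp [quadForm, mApp, inner_smul_right]

/-- A Mahalanobis projection onto a convex set does not increase the distance to its points. -/
lemma IsMProj.quadForm_sub_le {A : Matrix (Fin d) (Fin d) ℝ} (hA : A.PosDef)
    {C : Set (EuclideanSpace ℝ (Fin d))} (hC : Convex ℝ C) {y p u : EuclideanSpace ℝ (Fin d)}
    (hp : IsMProj A C y p) (hu : u ∈ C) : quadForm A (p - u) ≤ quadForm A (y - u) := by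
  have key : 0 ≤ ⟪p - y, mApp A (u - p)⟫ := by
    refine nonneg_of_forall_quadratic (c := quadForm A (u - p)) fun s hs₀ hs₁ => ?_
    have h := hp.2 _ (hC.add_smul_sub_mem hp.1 hu ⟨hs₀, hs₁⟩)
    have h2 := (Real.sqrt_le_sqrt_iff (quadForm_nonneg hA _)).1 h
    have hs : mApp A (s • (u - p)) = s • mApp A (u - p) := map_smul _ _ _
    rw [show p + s • (u - p) - y = (p - y) + s • (u - p) by abel, quadForm_add hA.isHermitian,
      quadForm_smul, hs, inner_smul_right] at h2
    linarith
  have hsplit := quadForm_add hA.isHermitian (y - p) (p - u)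
  have hneg : ⟪y - p, mApp A (p - u)⟫ = ⟪p - y, mApp A (u - p)⟫ := by
    have : mApp A (p - u) = -mApp A (u - p) := by
      rw [← neg_sub u p]; exact map_neg _ _
    rw [this, ← neg_sub p y, inner_neg_neg]
  rw [sub_add_sub_cancel, hneg] at hsplit
  linarith [quadForm_nonneg hA (y - p)]

lemma quadForm_newton_step {A : Matrix (Fin d) (Fin d) ℝ} (hA : A.PosDef) (c : ℝ)
    (z v : EuclideanSpace ℝ (Fin d)) :
    quadForm A (z - c • mApp A⁻¹ v) =
      quadForm A z - 2 * c * ⟪v, z⟫ + c ^ 2 * quadForm A⁻¹ v := by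
  have hinv : mApp A (mApp A⁻¹ v) = v := by
    rw [← mApp_mul, Matrix.mul_nonsing_inv _ hA.det_pos.ne'.isUnit]
    simp [mApp]
  have hs : mApp A ((-c) • mApp A⁻¹ v) = (-c) • v := by
    rw [show mApp A ((-c) • mApp A⁻¹ v) = (-c) • mApp A (mApp A⁻¹ v) from map_smul _ _ _, hinv]
  have hq : quadForm A (mApp A⁻¹ v) = quadForm A⁻¹ v := by
    rw [quadForm, hinv, real_inner_comm, quadForm]
  rw [sub_eq_add_neg, ← neg_smul, quadForm_add hA.isHermitian, hs, quadForm_smul, hq,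
    inner_smul_right, real_inner_comm]
  ring

lemma posSemidef_outerProd (v : EuclideanSpace ℝ (Fin d)) : (outerProd v).PosSemidef := by
  simpa [Matrix.vecMulVec, outerProd] using Matrix.posSemidef_vecMulVec_self_star v.ofLp

lemma trace_outerProd (v : EuclideanSpace ℝ (Fin d)) : (outerProd v).trace = ‖v‖ ^ 2 := by
  simp [Matrix.trace, outerProd, EuclideanSpace.real_norm_sq_eq, ← sq]

lemma det_sub_outerProd {A : Matrix (Fin d) (Fin d) ℝ} (hA : IsUnit A.det)
    (v : EuclideanSpace ℝ (Fin d)) :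
    (A - outerProd v).det = A.det * (1 - quadForm A⁻¹ v) := by
  have h := Matrix.det_add_replicateCol_mul_replicateRow (ι := Unit) hA (-v.ofLp) v.ofLp
  rw [Matrix.det_unique (n := Unit)] at h
  convert h using 1
  · congr 1
    ext i j
    simp [outerProd, Matrix.mul_apply, sub_eq_add_neg]
  · simp [quadForm, mApp, Matrix.toLpLin_apply, Matrix.mul_assoc, PiLp.inner_apply,
      Matrix.mul_apply, Matrix.mulVec, dotProduct, sub_eq_add_neg, mul_comm]

lemma quadForm_inv_le_log_det {A : Matrix (Fin d) (Fin d) ℝ} (hA : A.PosDef)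
    (v : EuclideanSpace ℝ (Fin d)) :
    quadForm (A + outerProd v)⁻¹ v ≤
      Real.log (A + outerProd v).det - Real.log A.det := by
  have hB : (A + outerProd v).PosDef := hA.add_posSemidef (posSemidef_outerProd v)
  have h := det_sub_outerProd hB.det_pos.ne'.isUnit v
  rw [add_sub_cancel_right] at h
  have hpos : 0 < 1 - quadForm (A + outerProd v)⁻¹ v :=
    pos_of_mul_pos_right (h ▸ hA.det_pos) hB.det_pos.le
  rw [h, Real.log_mul hB.det_pos.ne' hpos.ne']
  linarith [Real.log_le_sub_one_of_pos hpos]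

lemma log_det_le {A : Matrix (Fin d) (Fin d) ℝ} (hA : A.PosDef) {m : ℝ} (hm : 0 < m)
    (htr : A.trace ≤ d * m) : Real.log A.det ≤ d * Real.log m := by
  have hdet := hA.isHermitian.det_eq_prod_eigenvalues
  have htrace := hA.isHermitian.trace_eq_sum_eigenvalues
  simp only [RCLike.ofReal_real_eq_id, id_eq] at hdet htrace
  have hpos := hA.eigenvalues_pos
  rw [hdet, Real.log_prod fun i _ => (hpos i).ne']
  have hi : ∀ i, Real.log (hA.isHermitian.eigenvalues i) ≤
      hA.isHermitian.eigenvalues i / m + (Real.log m - 1) := fun i => by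
    have := Real.log_le_sub_one_of_pos (div_pos (hpos i) hm)
    rw [Real.log_div (hpos i).ne' hm.ne'] at this
    linarith
  refine (Finset.sum_le_sum fun i _ => hi i).trans ?_
  rw [Finset.sum_add_distrib, ← Finset.sum_div, ← htrace]
  have : A.trace / m ≤ d := (div_le_iff₀ hm).2 htr
  simp
  linarith

end Matrix

end LightONS

open LightONS
/-- regret of LightONS with `k = 2`, exact projections, and the surrogate
gradients of Lemma 6, so that `c_f = c_g = 1` and the regret matches ONS.
Rounds are indexed by `t ∈ {0, …, T-1}` (round `t+1` in the paper); iterates `x t`, `y t` are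
the paper's `x_{t+1}`, `y_{t+1}`, with `x 0 = y 0 = 0 ∈ X` (`X` is centered at the origin), and
`x t` is the Euclidean projection of `y t` onto `X` for every `t`. -/
theorem stmt_9 {d T : ℕ} (hd : 1 ≤ d)
    (X : Set (EuclideanSpace ℝ (Fin d))) (hne : X.Nonempty) (hcmp : IsCompact X)
    (hconv : Convex ℝ X) (hzero : (0 : EuclideanSpace ℝ (Fin d)) ∈ X)
    (D G α ε : ℝ) (hD : 0 < D) (hG : 0 < G) (hα : 0 < α) (hε : 0 < ε)
    (hdiam : ∀ x ∈ X, ∀ y ∈ X, ‖x - y‖ ≤ D)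
    (hXball : ∀ x ∈ X, ‖x‖ ≤ D / 2)
    (f : ℕ → EuclideanSpace ℝ (Fin d) → ℝ)
    (g : ℕ → EuclideanSpace ℝ (Fin d) → EuclideanSpace ℝ (Fin d))
    (hexp : ∀ t < T, ConcaveOn ℝ X (fun z => Real.exp (-α * f t z)))
    (hgrad : ∀ t < T, ∀ z ∈ X, HasGradientAt (f t) (g t z) z)
    (hgbound : ∀ t < T, ∀ z ∈ X, ‖g t z‖ ≤ G)
    (γ₀ : ℝ) (hγ₀ : γ₀ = (1/2) * min (1/(D*G)) α)
    (x y yhat v : ℕ → EuclideanSpace ℝ (Fin d)) (A : ℕ → Matrix (Fin d) (Fin d) ℝ)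
    (hx0 : x 0 = 0) (hy0 : y 0 = 0)
    (hA0 : A 0 = ε • (1 : Matrix (Fin d) (Fin d) ℝ))
    (hv₁ : ∀ t < T, y t ∈ X → v t = g t (x t))
    (hv₂ : ∀ t < T, y t ∉ X →
      v t = g t (x t) + (max 0 (-⟪g t (x t), y t - x t⟫) / ‖y t - x t‖^2) • (y t - x t))
    (hAstep : ∀ t < T, A (t+1) = A t + outerProd (v t))
    (hyhat : ∀ t < T, yhat (t+1) = y t - (1/γ₀) • mApp (A (t+1))⁻¹ (v t))
    (hupd₁ : ∀ t < T, ‖yhat (t+1)‖ ≤ 2*D/2 → y (t+1) = yhat (t+1))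
    (hupd₂ : ∀ t < T, ¬ (‖yhat (t+1)‖ ≤ 2*D/2) →
      IsMProj (A (t+1)) (Metric.closedBall (0 : EuclideanSpace ℝ (Fin d)) (D/2))
        (yhat (t+1)) (y (t+1)))
    (hxproj : ∀ t ≤ T, x t ∈ X ∧ ∀ z ∈ X, ‖x t - y t‖ ≤ ‖z - y t‖) :
    ∀ u ∈ X, (∑ t ∈ Finset.range T, (f t (x t) - f t u))
      ≤ (d / (2*γ₀)) * Real.log (1 + G^2 * T / (d * ε)) + γ₀ * ε * D^2 / 8 := by
  intro u hu
  have hγ : 0 < γ₀ := by rw [hγ₀]; positivity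
  have hγα : 2 * γ₀ ≤ α := by rw [hγ₀]; linarith [min_le_right (1 / (D * G)) α]
  have hγDG : 2 * γ₀ * (D * G) ≤ 1 := by
    rw [← le_div_iff₀ (by positivity), hγ₀]; linarith [min_le_left (1 / (D * G)) α]
  have hpos : ∀ t ≤ T, (A t).PosDef := by
    intro t
    induction t with
    | zero => intro _; rw [hA0]; exact Matrix.PosDef.one.smul hε
    | succ t ih =>
      intro ht
      rw [hAstep t ht]
      exact (ih (Nat.le_of_succ_le ht)).add_posSemidef (posSemidef_outerProd _)
  have hynorm : ∀ t ≤ T, ‖y t‖ ≤ D := by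
    intro t
    cases t with
    | zero => intro _; simp [hy0, hD.le]
    | succ t =>
      intro ht
      by_cases h : ‖yhat (t + 1)‖ ≤ 2 * D / 2
      · rw [hupd₁ t ht h]; linarith
      · have := mem_closedBall_zero_iff.1 (hupd₂ t ht h).1
        linarith
  have hsurr : ∀ t < T, ‖v t‖ ≤ G ∧ ⟪g t (x t), x t - u⟫ ≤ ⟪v t, y t - u⟫ := by
    intro t ht
    obtain ⟨hx, hmin⟩ := hxproj t ht.le
    by_cases hy : y t ∈ X
    · have hxy : x t = y t := by simpa [sub_eq_zero] using hmin _ hy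
      rw [hv₁ t ht hy, hxy]
      exact ⟨hgbound t ht _ hy, le_rfl⟩
    · have h := surrogate_gradient (g := g t (x t)) (u := u) (fun h => hy (h ▸ hx) : y t ≠ x t)
        (inner_sub_nonneg_of_norm_minimal hconv hx hmin hu)
      rw [hv₂ t ht hy]
      exact ⟨h.1.trans (hgbound t ht _ hx), h.2⟩
  have htrace : ∀ t ≤ T, (A t).trace ≤ d * ε + G ^ 2 * t := by
    intro t
    induction t with
    | zero => intro _; simp [hA0, mul_comm]
    | succ t ih =>
      intro ht
      rw [hAstep t ht, Matrix.trace_add, trace_outerProd]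
      have h₁ := ih (Nat.le_of_succ_le ht)
      have h₂ := pow_le_pow_left₀ (norm_nonneg _) (hsurr t ht).1 2
      push_cast
      linarith
  have hstep : ∀ t < T, f t (x t) - f t u ≤
      γ₀ / 2 * (quadForm (A t) (y t - u) - quadForm (A (t + 1)) (y (t + 1) - u)) +
        1 / (2 * γ₀) * (Real.log (A (t + 1)).det - Real.log (A t).det) := by
    intro t ht
    obtain ⟨hx, -⟩ := hxproj t ht.le
    have hA' := hpos (t + 1) ht
    obtain ⟨hvG, hle⟩ := hsurr t ht
    have hloss := sub_le_of_expConcave hγ hγα (hexp t ht) hx hu (hgrad t ht _ hx) (by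
      have := (abs_real_inner_le_norm (g t (x t)) (x t - u)).trans
        (mul_le_mul (hgbound t ht _ hx) (hdiam _ hx _ hu) (norm_nonneg _) hG.le)
      nlinarith)
    have hwG : ⟪v t, y t - u⟫ ≤ G * (3 / 2 * D) := by
      refine (real_inner_le_norm _ _).trans (mul_le_mul hvG ?_ (norm_nonneg _) hG.le)
      linarith [norm_sub_le (y t) u, hynorm t ht.le, hXball u hu]
    have hmono : ⟪g t (x t), x t - u⟫ - γ₀ / 2 * ⟪g t (x t), x t - u⟫ ^ 2 ≤
        ⟪v t, y t - u⟫ - γ₀ / 2 * ⟪v t, y t - u⟫ ^ 2 := by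
      have : γ₀ * ((⟪v t, y t - u⟫ + ⟪g t (x t), x t - u⟫) / 2) ≤ 1 := by
        nlinarith [mul_pos hD hG]
      nlinarith [mul_nonneg (sub_nonneg.2 hle) (sub_nonneg.2 this)]
    have hnewton := quadForm_newton_step hA' (1 / γ₀) (y t - u) (v t)
    rw [sub_right_comm, ← hyhat t ht] at hnewton
    have hproj : quadForm (A (t + 1)) (y (t + 1) - u) ≤
        quadForm (A (t + 1)) (yhat (t + 1) - u) := by
      by_cases h : ‖yhat (t + 1)‖ ≤ 2 * D / 2
      · rw [hupd₁ t ht h]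
      · exact IsMProj.quadForm_sub_le hA' (convex_closedBall _ _) (hupd₂ t ht h)
          (mem_closedBall_zero_iff.2 (hXball u hu))
    have hgrow : quadForm (A (t + 1)) (y t - u) =
        quadForm (A t) (y t - u) + ⟪v t, y t - u⟫ ^ 2 := by
      rw [hAstep t ht, quadForm_add_outerProd]
    have hdet := quadForm_inv_le_log_det (hpos t ht.le) (v t)
    rw [← hAstep t ht] at hdet
    rw [hnewton, hgrow] at hproj
    have h₁ := mul_le_mul_of_nonneg_left hproj (by positivity : 0 ≤ γ₀ / 2)
    have h₂ := mul_le_mul_of_nonneg_left hdet (by positivity : 0 ≤ 1 / (2 * γ₀))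
    have h₃ : γ₀ / 2 * (quadForm (A t) (y t - u) + ⟪v t, y t - u⟫ ^ 2
        - 2 * (1 / γ₀) * ⟪v t, y t - u⟫ + (1 / γ₀) ^ 2 * quadForm (A (t + 1))⁻¹ (v t)) =
        γ₀ / 2 * quadForm (A t) (y t - u) + γ₀ / 2 * ⟪v t, y t - u⟫ ^ 2 - ⟪v t, y t - u⟫ +
          1 / (2 * γ₀) * quadForm (A (t + 1))⁻¹ (v t) := by
      field_simp
    linarith
  refine (Finset.sum_le_sum fun t ht => hstep t (Finset.mem_range.1 ht)).trans ?_
  rw [Finset.sum_add_distrib, ← Finset.mul_sum, ← Finset.mul_sum,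
    Finset.sum_range_sub' (fun t => quadForm (A t) (y t - u)),
    Finset.sum_range_sub (fun t => Real.log (A t).det)]
  have hd' : (0 : ℝ) < d := by exact_mod_cast hd
  have hm : 0 < ε + G ^ 2 * T / d := by positivity
  have hlogT := log_det_le (hpos T le_rfl) hm (by
    rw [mul_add, mul_div_cancel₀ _ hd'.ne']; exact htrace T le_rfl)
  have hlog0 : Real.log (A 0).det = d * Real.log ε := by simp [hA0]
  have hratio : 1 + G ^ 2 * T / (d * ε) = (ε + G ^ 2 * T / d) / ε := by field_simp
  have hQ0 : quadForm (A 0) (y 0 - u) ≤ ε * (D / 2) ^ 2 := by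
    rw [hA0, hy0, quadForm_smul_one, zero_sub, norm_neg]
    gcongr
    exact hXball u hu
  have hlog : Real.log (A T).det - Real.log (A 0).det ≤
      d * Real.log (1 + G ^ 2 * T / (d * ε)) := by
    rw [hratio, Real.log_div hm.ne' hε.ne', hlog0]
    linarith
  have h₁ := mul_le_mul_of_nonneg_left hlog (by positivity : 0 ≤ 1 / (2 * γ₀))
  have h₂ : γ₀ / 2 * (quadForm (A 0) (y 0 - u) - quadForm (A T) (y T - u)) ≤
      γ₀ / 2 * (ε * (D / 2) ^ 2) := by
    gcongr
    linarith [quadForm_nonneg (hpos T le_rfl) (y T - u)]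
  calc _ ≤ γ₀ / 2 * (ε * (D / 2) ^ 2) +
        1 / (2 * γ₀) * (d * Real.log (1 + G ^ 2 * T / (d * ε))) := add_le_add h₂ h₁
    _ = _ := by ring
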